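/- In the gap-recovery setup, let 1 ≥ p > q ≥ 0, let Y* = diag(J_{s_1×s_1}, …, J_{s_K×s_K}) be the ground-truth cluster matrix, and set s̲ = s_{r+1} (with s̲ = 0 if r = K). Then for any Y ∈ F_n: ⟨Ȳ − Y, (p−q)·(Y* − (1/2)J)⟩ ≥ ((p−q)/2)·‖J̄ ∘ (Y − Ȳ)‖_1 − ((p−q)/2)·s̲·tr((I − QQᵀ)·Y·(I − QQᵀ)). (The last trace equals the nuclear norm of (I − QQᵀ)(Y − Ȳ)(I − QQᵀ), which is positive semidefinite; and (p−q)(Y* − (1/2)J) = E A − ((p+q)/2)J for the SBM mean E A = (p−q)Y* + qJ.) -/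

import Mathlib

open Matrix

/-- Feasible set of the recovery SDP: symmetric PSD matrices with entries in `[0,1]`. -/
def FeasSDP {d : ℕ} (Y : Matrix (Fin d) (Fin d) ℝ) : Prop :=
  Y.PosSemidef ∧ ∀ i j, 0 ≤ Y i j ∧ Y i j ≤ 1

/-- Entrywise ℓ¹ norm of a matrix. -/
noncomputable def l1Norm {n : ℕ} (X : Matrix (Fin n) (Fin n) ℝ) : ℝ :=
  ∑ i, ∑ j, |X i j|

/-- Trace inner product `⟨X, Y⟩ = Σ_{i,j} X_{ij} Y_{ij}`. -/
noncomputable def mip {d : ℕ} (X Y : Matrix (Fin d) (Fin d) ℝ) : ℝ :=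
  ∑ i, ∑ j, X i j * Y i j

theorem psd_offdiag_le {n : ℕ} {Y : Matrix (Fin n) (Fin n) ℝ} (h : Y.PosSemidef) (i j : Fin n) :
    Y i j ≤ (Y i i + Y j j) / 2 := by
  have h1 := h.dotProduct_mulVec_nonneg (Pi.single i 1 - Pi.single j 1)
  have h2 : Y j i = Y i j := by simpa using h.1.apply i j
  simp [Matrix.mulVec_sub, sub_dotProduct, dotProduct_sub] at h1
  linarith

/-- Signal term bound in the gap-recovery setup: for `Y* = diag(J_{s_1},…,J_{s_K})`,
`s̲ = s_{r+1}` (`0` if `r` is the last cluster), and any `Y ∈ F_n`: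
`⟨Ȳ − Y, (p−q)(Y* − (1/2)J)⟩ ≥ ((p−q)/2)‖J̄∘(Y−Ȳ)‖₁ − ((p−q)/2)·s̲·tr((I−QQᵀ)Y(I−QQᵀ))`. -/
theorem gap_recovery_signal_term_bound
    {n K : ℕ} (s : Fin K → ℕ) (hs : Antitone s) (hspos : ∀ k, 0 < s k)
    (c : Fin n → Fin K) (hc : Monotone c)
    (hcount : ∀ k, (Finset.univ.filter fun i => c i = k).card = s k)
    (r : Fin K)
    (p q : ℝ) (hp : p ≤ 1) (hpq : q < p) (hq : 0 ≤ q)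
    (P Yb Jbar Ystar Jmat : Matrix (Fin n) (Fin n) ℝ)
    (hP : P = Matrix.of fun i j =>
      if c i = c j ∧ c i ≤ r then (1 : ℝ) / (s (c i) : ℝ) else 0)
    (hYb : Yb = Matrix.of fun i j => if c i = c j ∧ c i ≤ r then (1 : ℝ) else 0)
    (hJbar : Jbar = Matrix.of fun i j => if c i ≤ r ∨ c j ≤ r then (1 : ℝ) else 0)
    (hYstar : Ystar = Matrix.of fun i j => if c i = c j then (1 : ℝ) else 0)
    (hJmat : Jmat = Matrix.of fun _ _ => (1 : ℝ))
    (sLow : ℝ)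
    (hsLow : sLow = if h : (r : ℕ) + 1 < K then (s ⟨(r : ℕ) + 1, h⟩ : ℝ) else 0)
    (Y : Matrix (Fin n) (Fin n) ℝ) (hY : FeasSDP Y) :
    (p - q) / 2 * l1Norm (Matrix.hadamard Jbar (Y - Yb)) -
        (p - q) / 2 * sLow * ((1 - P) * Y * (1 - P)).trace ≤
      mip (Yb - Y) ((p - q) • (Ystar - (1 / 2 : ℝ) • Jmat)) := by
  obtain ⟨hpsd, hbd⟩ := hY
  have hPt : (1 - P)ᴴ = 1 - P := by
    rw [Matrix.conjTranspose_sub, Matrix.conjTranspose_one]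
    congr 1
    subst hP
    ext i j
    simp only [Matrix.conjTranspose_apply, Matrix.of_apply, star_trivial]
    by_cases h : c i = c j
    · simp [h]
    · simp [h, Ne.symm h]
  have hZ : ((1 - P) * Y * (1 - P)).PosSemidef := by
    have := hpsd.mul_mul_conjTranspose_same (1 - P)
    rwa [hPt] at this
  have hrow : ∀ i, r < c i → ((1 - P) * Y * (1 - P)) i i = Y i i := by
    intro i hi
    have hP1 : ∀ j, P i j = 0 := by
      intro j; subst hP; simp [not_le.mpr hi]
    have hP2 : ∀ j, P j i = 0 := by
      intro j; subst hP
      simp only [Matrix.of_apply]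
      rw [if_neg]
      rintro ⟨h1, h2⟩
      exact absurd (h1 ▸ h2) (not_le.mpr hi)
    simp [Matrix.mul_apply, Matrix.sub_apply, hP1, hP2, Matrix.one_apply]
  have htr : ∑ i, (if r < c i then Y i i else 0) ≤ ((1 - P) * Y * (1 - P)).trace := by
    unfold Matrix.trace
    refine Finset.sum_le_sum fun i _ => ?_
    simp only [Matrix.diag_apply]
    split_ifs with h
    · exact (hrow i h).ge
    · exact hZ.diag_nonneg
  have hcnt : ∀ k, ∑ j, (if k = c j then (1 : ℝ) else 0) = s k := by
    intro k
    rw [← hcount k]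
    simp [eq_comm]
  have hsl : ∀ i, r < c i → (s (c i) : ℝ) ≤ sLow := by
    intro i hi
    have h : (r : ℕ) + 1 < K := lt_of_le_of_lt (Nat.succ_le_of_lt hi) (c i).2
    rw [hsLow, dif_pos h]
    exact_mod_cast hs (show (⟨(r : ℕ) + 1, h⟩ : Fin K) ≤ c i from Nat.succ_le_of_lt hi)
  have hA : ∑ i, ∑ j, (if c i = c j ∧ r < c i then Y i i else 0)
      ≤ sLow * ∑ i, (if r < c i then Y i i else 0) := by
    rw [Finset.mul_sum]
    refine Finset.sum_le_sum fun i _ => ?_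
    by_cases h : r < c i
    · have : ∑ j, (if c i = c j ∧ r < c i then Y i i else 0)
          = (∑ j, (if c i = c j then (1 : ℝ) else 0)) * Y i i := by
        rw [Finset.sum_mul]
        refine Finset.sum_congr rfl fun j _ => ?_
        simp [h]
      rw [this, hcnt, if_pos h]
      exact mul_le_mul_of_nonneg_right (hsl i h) (hbd i i).1
    · simp [h]
  have hA' : ∑ i, ∑ j, (if c i = c j ∧ r < c i then Y j j else 0)
      = ∑ i, ∑ j, (if c i = c j ∧ r < c i then Y i i else 0) := by
    rw [Finset.sum_comm]
    refine Finset.sum_congr rfl fun i _ => Finset.sum_congr rfl fun j _ => ?_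
    by_cases h : c i = c j
    · simp [h]
    · simp [h, Ne.symm h]
  have hB : ∑ i, ∑ j, (if c i = c j ∧ r < c i then Y i j else 0)
      ≤ ∑ i, ∑ j, (if c i = c j ∧ r < c i then Y i i else 0) := by
    have : ∑ i, ∑ j, (if c i = c j ∧ r < c i then Y i j else 0)
      ≤ ∑ i, ∑ j, ((if c i = c j ∧ r < c i then Y i i else 0)
        + (if c i = c j ∧ r < c i then Y j j else 0)) / 2 := by
      refine Finset.sum_le_sum fun i _ => Finset.sum_le_sum fun j _ => ?_
      split_ifs
      · exact psd_offdiag_le hpsd i j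
      · simp
    simp only [← Finset.sum_div, Finset.sum_add_distrib] at this
    rw [hA'] at this
    linarith
  have hs0 : 0 ≤ sLow := by
    rw [hsLow]; split_ifs <;> positivity
  have hfin : ∑ i, ∑ j, (if c i = c j ∧ r < c i then Y i j else 0)
      ≤ sLow * ((1 - P) * Y * (1 - P)).trace :=
    hB.trans (hA.trans (mul_le_mul_of_nonneg_left htr hs0))
  have hd : 0 < (p - q) / 2 := by linarith
  have hmain : (p - q) / 2 * (l1Norm (Matrix.hadamard Jbar (Y - Yb))
      - ∑ i, ∑ j, (if c i = c j ∧ r < c i then Y i j else 0))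
      ≤ mip (Yb - Y) ((p - q) • (Ystar - (1 / 2 : ℝ) • Jmat)) := by
    unfold l1Norm mip
    rw [← Finset.sum_sub_distrib, Finset.mul_sum]
    refine Finset.sum_le_sum fun i _ => ?_
    rw [← Finset.sum_sub_distrib, Finset.mul_sum]
    refine Finset.sum_le_sum fun j _ => ?_
    obtain ⟨h0, h1⟩ := hbd i j
    have e1 : |Y i j - 1| = 1 - Y i j := by rw [abs_sub_comm, abs_of_nonneg (by linarith)]
    have e2 : |Y i j| = Y i j := abs_of_nonneg h0
    have e3 := mul_nonneg hd.le h0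
    subst hYb hJbar hYstar hJmat
    simp only [Matrix.hadamard_apply, Matrix.sub_apply, Matrix.smul_apply, Matrix.of_apply,
      smul_eq_mul]
    by_cases hij : c i = c j
    · by_cases hr : c i ≤ r
      · have hr' : c j ≤ r := hij ▸ hr
        simp [hij, hr', not_lt.mpr hr', e1]
        linarith
      · have hr' : ¬ c j ≤ r := hij ▸ hr
        simp [hij, hr', not_le.mp hr']
        linarith
    · by_cases hr : c i ≤ r ∨ c j ≤ r
      · simp [hij, hr, e2]
        linarith
      · simp [hij, hr]
        linarith
  have := mul_le_mul_of_nonneg_left hfin hd.le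
  linarith
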